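/- arXiv:2510.15169 — 5 statements merged into one kernel-verified Lean document; each statement's English description precedes it below -/
import Mathlib

section
/- Let n ≥ 2 and 1 ≤ m ≤ n−1. The set C_m := {Σ_{i=1}^{n−1} a_i α_i : a_i ∈ ℝ, a_1 > ⋯ > a_{n−m}, a_{n−m} < a_{n−m+1} < ⋯ < a_{n−1}, a_{n−m} > 0} is a big chamber of C(Φ⁺): it is a connected component of the set of regular vectors of C(Φ⁺). -/
/-- The positive root `α_{i,j} = e_i − e_j` of type `A_{n−1}` as a vector (1-based indices). -/
noncomputable def rootR (i j : ℕ) : ℕ → ℝ := fun k => (if k = i then 1 else 0) - (if k = j then 1 else 0)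

/-- The set of positive roots of type `A_{n−1}`. -/
def posRoots (n : ℕ) : Set (ℕ → ℝ) := {v | ∃ i j, 1 ≤ i ∧ i < j ∧ j ≤ n ∧ v = rootR i j}

/-- The cone of nonnegative real linear combinations of the elements of a finite set. -/
def coneOf (T : Finset (ℕ → ℝ)) : Set (ℕ → ℝ) :=
  {v | ∃ c : (ℕ → ℝ) → ℝ, (∀ x ∈ T, 0 ≤ c x) ∧ v = ∑ x ∈ T, c x • x}

/-- The cone `C(Φ⁺)` generated by the positive roots. -/
def conePos (n : ℕ) : Set (ℕ → ℝ) :=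
  {v | ∃ T : Finset (ℕ → ℝ), ↑T ⊆ posRoots n ∧ v ∈ coneOf T}

/-- A vector is singular if it lies in the cone of at most `n − 2` positive roots. -/
def IsSingular (n : ℕ) (v : ℕ → ℝ) : Prop :=
  ∃ T : Finset (ℕ → ℝ), ↑T ⊆ posRoots n ∧ T.card ≤ n - 2 ∧ v ∈ coneOf T

/-- The set of regular vectors of `C(Φ⁺)`. -/
def regularSet (n : ℕ) : Set (ℕ → ℝ) := {v | v ∈ conePos n ∧ ¬ IsSingular n v}

/-- The chamber `C_m`. -/
def Cm (n m : ℕ) : Set (ℕ → ℝ) :=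
  {v | ∃ a : ℕ → ℝ,
    (∀ i, 1 ≤ i → i + 1 ≤ n - m → a (i + 1) < a i) ∧
    (∀ i, n - m ≤ i → i + 1 ≤ n - 1 → a i < a (i + 1)) ∧
    0 < a (n - m) ∧
    v = ∑ i ∈ Finset.Icc 1 (n - 1), a i • rootR i (i + 1)}

open Finset in
lemma sum_mem_coneOf (n : ℕ) (I : Finset ℕ) (r : ℕ → ℕ → ℝ) (c : ℕ → ℝ)
    (hr : ∀ i ∈ I, r i ∈ posRoots n) (hc : ∀ i ∈ I, 0 ≤ c i) :
    ∃ T : Finset (ℕ → ℝ), ↑T ⊆ posRoots n ∧ T.card ≤ I.card ∧ (∑ i ∈ I, c i • r i) ∈ coneOf T := by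
  classical
  refine ⟨I.image r, ?_, Finset.card_image_le, fun x => ∑ i ∈ I with r i = x, c i, ?_, ?_⟩
  · intro x hx
    simp only [Finset.coe_image, Set.mem_image, Finset.mem_coe] at hx
    obtain ⟨i, hi, rfl⟩ := hx
    exact hr i hi
  · intro x _
    exact Finset.sum_nonneg fun i hi => hc i (Finset.mem_filter.1 hi).1
  · rw [← Finset.sum_fiberwise_of_maps_to (g := r) (t := I.image r)
      (fun i hi => Finset.mem_image_of_mem r hi)]
    refine Finset.sum_congr rfl fun x _ => ?_
    rw [Finset.sum_smul]
    refine Finset.sum_congr rfl fun i hi => ?_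
    rw [(Finset.mem_filter.1 hi).2]

/-- The hyperplane. -/
def inV (n : ℕ) (v : ℕ → ℝ) : Prop := (∀ k, (k < 1 ∨ n < k) → v k = 0) ∧ ∑ k ∈ Finset.Icc 1 n, v k = 0

lemma rootR_sum (S : Finset ℕ) (i j : ℕ) :
    ∑ k ∈ S, rootR i j k = (if i ∈ S then 1 else 0) - (if j ∈ S then 1 else 0) := by
  simp [rootR, Finset.sum_sub_distrib]

lemma conePos_inV {n : ℕ} {v : ℕ → ℝ} (h : v ∈ conePos n) : inV n v := by
  obtain ⟨T, hT, c, hc, rfl⟩ := h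
  constructor
  · intro k hk
    rw [Finset.sum_apply]
    refine Finset.sum_eq_zero fun x hx => ?_
    obtain ⟨i, j, h1, h2, h3, rfl⟩ := hT hx
    have h4 : k ≠ i := by omega
    have h5 : k ≠ j := by omega
    simp [rootR, h4, h5]
  · simp only [Finset.sum_apply]
    rw [Finset.sum_comm]
    refine Finset.sum_eq_zero fun x hx => ?_
    obtain ⟨i, j, h1, h2, h3, rfl⟩ := hT hx
    simp only [Pi.smul_apply, smul_eq_mul]
    rw [← Finset.mul_sum, rootR_sum, if_pos (by simp; omega), if_pos (by simp; omega)]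
    simp

lemma closed_sum {n : ℕ} {T : Finset (ℕ → ℝ)} (hT : ↑T ⊆ posRoots n) {v : ℕ → ℝ} (hv : v ∈ coneOf T)
    (S : Finset ℕ) (hS : ∀ i j, i < j → rootR i j ∈ T → (i ∈ S ↔ j ∈ S)) :
    ∑ k ∈ S, v k = 0 := by
  obtain ⟨c, hc, rfl⟩ := hv
  simp only [Finset.sum_apply]
  rw [Finset.sum_comm]
  refine Finset.sum_eq_zero fun x hx => ?_
  obtain ⟨i, j, h1, h2, h3, rfl⟩ := hT hx
  simp only [Pi.smul_apply, smul_eq_mul]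
  rw [← Finset.mul_sum, rootR_sum]
  simp [hS i j h2 hx]

lemma closed_min {n : ℕ} {T : Finset (ℕ → ℝ)} (hT : ↑T ⊆ posRoots n) {v : ℕ → ℝ} (hv : v ∈ coneOf T)
    (S : Finset ℕ) (hS : ∀ i j, i < j → rootR i j ∈ T → (i ∈ S ↔ j ∈ S)) (k : ℕ) (hk : k ∈ S)
    (hmin : ∀ l ∈ S, k ≤ l) : 0 ≤ v k := by
  obtain ⟨c, hc, rfl⟩ := hv
  simp only [Finset.sum_apply]
  refine Finset.sum_nonneg fun x hx => ?_
  refine mul_nonneg (hc x hx) ?_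
  obtain ⟨i, j, h1, h2, h3, rfl⟩ := hT hx
  have hkj : k ≠ j := by
    rintro rfl
    have := hmin i ((hS i k h2 hx).2 hk)
    omega
  simp only [rootR, if_neg hkj, sub_zero]
  split_ifs <;> norm_num

lemma closed_max {n : ℕ} {T : Finset (ℕ → ℝ)} (hT : ↑T ⊆ posRoots n) {v : ℕ → ℝ} (hv : v ∈ coneOf T)
    (S : Finset ℕ) (hS : ∀ i j, i < j → rootR i j ∈ T → (i ∈ S ↔ j ∈ S)) (k : ℕ) (hk : k ∈ S)
    (hmax : ∀ l ∈ S, l ≤ k) : v k ≤ 0 := by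
  obtain ⟨c, hc, rfl⟩ := hv
  simp only [Finset.sum_apply]
  refine Finset.sum_nonpos fun x hx => ?_
  refine mul_nonpos_of_nonneg_of_nonpos (hc x hx) ?_
  obtain ⟨i, j, h1, h2, h3, rfl⟩ := hT hx
  have hkj : k ≠ i := by
    rintro rfl
    have := hmax j ((hS k j h2 hx).1 hk)
    omega
  simp only [rootR, if_neg hkj, zero_sub]
  split_ifs <;> norm_num

lemma rootR_inj {i j i' j' : ℕ} (h : i < j) (h' : i' < j') (e : rootR i j = rootR i' j') :
    i = i' ∧ j = j' := by
  have h1 := congrFun e i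
  have h2 := congrFun e j
  have e1 : i ≠ j := by omega
  have e2 : j ≠ i := by omega
  simp only [rootR, if_true, if_neg e1, if_neg e2] at h1 h2
  constructor
  · by_contra hne
    rw [if_neg hne] at h1
    split_ifs at h1 <;> norm_num at h1
  · by_contra hne
    rw [if_neg hne] at h2
    split_ifs at h2 <;> norm_num at h2

lemma exists_closed {n : ℕ} (hn : 2 ≤ n) {T : Finset (ℕ → ℝ)} (hT : ↑T ⊆ posRoots n)
    (hcard : T.card ≤ n - 2) :
    ∃ S ⊆ Finset.Icc 1 n, S.Nonempty ∧ (Finset.Icc 1 n \ S).Nonempty ∧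
      ∀ i j, i < j → rootR i j ∈ T → (i ∈ S ↔ j ∈ S) := by
  classical
  let V := ↥(Finset.Icc 1 n)
  let G : SimpleGraph V := SimpleGraph.fromRel (fun u w => u.1 < w.1 ∧ rootR u.1 w.1 ∈ T)
  have hmem : ∀ i j, i < j → rootR i j ∈ T → i ∈ Finset.Icc 1 n ∧ j ∈ Finset.Icc 1 n := by
    intro i j hij h
    obtain ⟨i', j', h1, h2, h3, e⟩ := hT h
    obtain ⟨rfl, rfl⟩ := rootR_inj hij h2 e
    simp; omega
  have hG : ¬ G.Connected := by
    intro hc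
    have h1 := hc.card_vert_le_card_edgeSet_add_one
    have hV : Nat.card V = n := by
      rw [Nat.card_eq_fintype_card, Fintype.card_coe]; simp
    have hne : Nonempty V := hc.nonempty
    let f : (ℕ → ℝ) → Sym2 V := fun x =>
      if h : ∃ e : V × V, e.1.1 < e.2.1 ∧ x = rootR e.1.1 e.2.1 then s(h.choose.1, h.choose.2)
      else s(hne.some, hne.some)
    have hf : ∀ u w : V, u.1 < w.1 → f (rootR u.1 w.1) = s(u, w) := by
      intro u w huw
      have h : ∃ e : V × V, e.1.1 < e.2.1 ∧ rootR u.1 w.1 = rootR e.1.1 e.2.1 := ⟨(u, w), huw, rfl⟩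
      have hs := h.choose_spec
      have := rootR_inj huw hs.1 hs.2
      simp only [f, dif_pos h]
      have q1 : h.choose.1 = u := Subtype.ext this.1.symm
      have q2 : h.choose.2 = w := Subtype.ext this.2.symm
      rw [q1, q2]
    have hsub : G.edgeSet ⊆ (↑(T.image f) : Set (Sym2 V)) := by
      intro e he
      induction e using Sym2.ind with
      | _ u w =>
        rw [SimpleGraph.mem_edgeSet, SimpleGraph.fromRel_adj] at he
        rw [Finset.mem_coe, Finset.mem_image]
        rcases he.2 with h | h
        · exact ⟨_, h.2, hf _ _ h.1⟩
        · exact ⟨_, h.2, (hf _ _ h.1).trans Sym2.eq_swap⟩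
    have h2 : Nat.card G.edgeSet ≤ T.card := by
      refine (Nat.card_mono (Finset.finite_toSet _) hsub).trans ?_
      rw [Nat.card_coe_set_eq, Set.ncard_coe_finset]
      exact Finset.card_image_le
    omega
  have hne : Nonempty V := ⟨⟨1, by simp; omega⟩⟩
  have hp : ¬ G.Preconnected := fun h => hG ⟨h⟩
  unfold SimpleGraph.Preconnected at hp
  push Not at hp
  obtain ⟨u, w, huw⟩ := hp
  refine ⟨(Finset.Icc 1 n).filter (fun k => ∃ h : k ∈ Finset.Icc 1 n, G.Reachable u ⟨k, h⟩),
    Finset.filter_subset _ _, ⟨u.1, ?_⟩, ⟨w.1, ?_⟩, ?_⟩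
  · exact Finset.mem_filter.2 ⟨u.2, u.2, SimpleGraph.Reachable.refl _⟩
  · refine Finset.mem_sdiff.2 ⟨w.2, fun h => ?_⟩
    obtain ⟨_, h⟩ := (Finset.mem_filter.1 h).2
    exact huw h
  · intro i j hij h
    obtain ⟨hi, hj⟩ := hmem i j hij h
    have hadj : G.Adj ⟨i, hi⟩ ⟨j, hj⟩ := by
      rw [SimpleGraph.fromRel_adj]
      exact ⟨fun e => by have := congrArg Subtype.val e; simp at this; omega, Or.inl ⟨hij, h⟩⟩
    simp only [Finset.mem_filter]
    constructor
    · rintro ⟨_, _, h⟩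
      exact ⟨hj, hj, h.trans hadj.reachable⟩
    · rintro ⟨_, _, h⟩
      exact ⟨hi, hi, h.trans hadj.symm.reachable⟩

/-- Strict inequalities. -/
def Uset (n p : ℕ) : Set (ℕ → ℝ) :=
  {v | (∀ j ∈ Finset.Icc 2 p, v j < 0) ∧ (∀ j ∈ Finset.Ico (p+1) n, 0 < v j) ∧
    0 < ∑ k ∈ Finset.Icc 1 p, v k}

/-- Weak inequalities. -/
def Fset (n p : ℕ) : Set (ℕ → ℝ) :=
  {v | (∀ j ∈ Finset.Icc 2 p, v j ≤ 0) ∧ (∀ j ∈ Finset.Ico (p+1) n, 0 ≤ v j) ∧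
    0 ≤ ∑ k ∈ Finset.Icc 1 p, v k}

lemma Uset_open (n p : ℕ) : IsOpen (Uset n p) := by
  have : Uset n p = (⋂ j ∈ Finset.Icc 2 p, {v : ℕ → ℝ | v j < 0}) ∩
      ((⋂ j ∈ Finset.Ico (p+1) n, {v : ℕ → ℝ | 0 < v j}) ∩ {v | 0 < ∑ k ∈ Finset.Icc 1 p, v k}) := by
    ext v; simp only [Uset, Set.mem_inter_iff, Set.mem_iInter, Set.mem_ofPred_eq]
  rw [this]
  refine IsOpen.inter (isOpen_biInter_finset fun j _ => ?_)
    (IsOpen.inter (isOpen_biInter_finset fun j _ => ?_) ?_)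
  · exact isOpen_lt (by fun_prop) (by fun_prop)
  · exact isOpen_lt (by fun_prop) (by fun_prop)
  · exact isOpen_lt (by fun_prop) (by fun_prop)

lemma Fset_closed (n p : ℕ) : IsClosed (Fset n p) := by
  have : Fset n p = (⋂ j ∈ Finset.Icc 2 p, {v : ℕ → ℝ | v j ≤ 0}) ∩
      ((⋂ j ∈ Finset.Ico (p+1) n, {v : ℕ → ℝ | 0 ≤ v j}) ∩ {v | 0 ≤ ∑ k ∈ Finset.Icc 1 p, v k}) := by
    ext v; simp only [Fset, Set.mem_inter_iff, Set.mem_iInter, Set.mem_ofPred_eq]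
  rw [this]
  refine IsClosed.inter (isClosed_biInter fun j _ => ?_)
    (IsClosed.inter (isClosed_biInter fun j _ => ?_) ?_)
  · exact isClosed_le (by fun_prop) (by fun_prop)
  · exact isClosed_le (by fun_prop) (by fun_prop)
  · exact isClosed_le (by fun_prop) (by fun_prop)

lemma Uset_sub_Fset (n p : ℕ) : Uset n p ⊆ Fset n p :=
  fun _ h => ⟨fun j hj => (h.1 j hj).le, fun j hj => (h.2.1 j hj).le, h.2.2.le⟩

lemma not_singular {n p : ℕ} (hp1 : 1 ≤ p) (hp2 : p ≤ n - 1) (hn : 2 ≤ n) {v : ℕ → ℝ}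
    (hU : v ∈ Uset n p) : ¬ IsSingular n v := by
  rintro ⟨T, hT, hcard, hv⟩
  obtain ⟨U1, U2, U3⟩ := hU
  obtain ⟨S, hS, hne, hne', hcl⟩ := exists_closed hn hT hcard
  have hmem : ∀ i j, i < j → rootR i j ∈ T → i ∈ Finset.Icc 1 n ∧ j ∈ Finset.Icc 1 n := by
    intro i j hij h
    obtain ⟨i', j', h1, h2, h3, e⟩ := hT h
    obtain ⟨rfl, rfl⟩ := rootR_inj hij h2 e
    simp; omega
  have hcompl : ∀ S : Finset ℕ, (∀ i j, i < j → rootR i j ∈ T → (i ∈ S ↔ j ∈ S)) →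
      (∀ i j, i < j → rootR i j ∈ T → (i ∈ Finset.Icc 1 n \ S ↔ j ∈ Finset.Icc 1 n \ S)) := by
    intro S hS i j hij h
    have := hmem i j hij h
    simp only [Finset.mem_sdiff, this, hS i j hij h]
  have key : ∀ S ⊆ Finset.Icc 1 n, S.Nonempty →
      (∀ i j, i < j → rootR i j ∈ T → (i ∈ S ↔ j ∈ S)) → 1 ∈ S := by
    intro S hS hne hcl
    by_contra h1
    have hmin : ∀ l ∈ S, p + 1 ≤ l := by
      intro l hl
      by_contra hlt
      have hm := S.min'_mem hne
      have hm2 := closed_min hT hv S hcl _ hm (fun l hl => S.min'_le l hl)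
      have hm3 := S.min'_le l hl
      have hm4 := Finset.mem_Icc.1 (hS hm)
      have hm5 : S.min' hne ≠ 1 := fun h => h1 (h ▸ hm)
      have := U1 (S.min' hne) (by simp only [Finset.mem_Icc]; omega)
      linarith
    have hnS : n ∈ S := by
      by_contra hnn
      have hm := S.max'_mem hne
      have hm2 := closed_max hT hv S hcl _ hm (fun l hl => S.le_max' l hl)
      have hm3 := hmin _ hm
      have hm4 := Finset.mem_Icc.1 (hS hm)
      have hm5 : S.max' hne ≠ n := fun h => hnn (h ▸ hm)
      have := U2 (S.max' hne) (by simp only [Finset.mem_Ico]; omega)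
      linarith
    have hR : Finset.Icc 1 n \ S = Finset.Icc 1 p := by
      have hne2 : (Finset.Icc 1 n \ S).Nonempty := ⟨1, by simp [h1]; omega⟩
      have hm := Finset.max'_mem _ hne2
      have hm2 := closed_max hT hv _ (hcompl S hcl) _ hm (fun l hl => Finset.le_max' _ l hl)
      have hm4 := Finset.mem_sdiff.1 hm
      have hm6 := Finset.mem_Icc.1 hm4.1
      have hm5 : (Finset.Icc 1 n \ S).max' hne2 ≠ n := fun h => hm4.2 (h.symm ▸ hnS)
      have hle : (Finset.Icc 1 n \ S).max' hne2 ≤ p := by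
        by_contra hgt
        have := U2 ((Finset.Icc 1 n \ S).max' hne2) (by simp only [Finset.mem_Ico]; omega)
        linarith
      ext k
      constructor
      · intro hk
        have := Finset.le_max' _ k hk
        have h7 := Finset.mem_Icc.1 (Finset.mem_sdiff.1 hk).1
        simp only [Finset.mem_Icc]; omega
      · intro hk
        have h7 := Finset.mem_Icc.1 hk
        refine Finset.mem_sdiff.2 ⟨by simp only [Finset.mem_Icc]; omega, fun h => ?_⟩
        have := hmin k h
        omega
    have := closed_sum hT hv _ (hcompl S hcl)
    rw [hR] at this
    linarith
  have a := key S hS hne hcl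
  have b := key _ Finset.sdiff_subset hne' (hcompl S hcl)
  exact (Finset.mem_sdiff.1 b).2 a

lemma simple_sum_apply (n : ℕ) (a : ℕ → ℝ) (k : ℕ) :
    (∑ i ∈ Finset.Icc 1 (n - 1), a i • rootR i (i + 1)) k =
      (if k ∈ Finset.Icc 1 (n-1) then a k else 0) - (if k ∈ Finset.Icc 2 n then a (k-1) else 0) := by
  simp only [Finset.sum_apply, Pi.smul_apply, smul_eq_mul, rootR, mul_sub, Finset.sum_sub_distrib,
    mul_ite, mul_one, mul_zero, Finset.sum_ite_eq]
  congr 1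
  split_ifs with h
  · rw [Finset.sum_eq_single (k-1)]
    · rw [if_pos (by simp at h; omega)]
    · intro b _ hb
      rw [if_neg (by omega)]
    · intro hk
      simp at h hk; omega
  · refine Finset.sum_eq_zero fun i hi => if_neg ?_
    simp at h hi; omega

lemma simple_partial (n : ℕ) (a : ℕ → ℝ) (p : ℕ) (hp : p ∈ Finset.Icc 1 (n-1)) :
    ∑ k ∈ Finset.Icc 1 p, (∑ i ∈ Finset.Icc 1 (n - 1), a i • rootR i (i + 1)) k = a p := by
  simp only [Finset.sum_apply]
  rw [Finset.sum_comm]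
  simp only [Pi.smul_apply, smul_eq_mul, ← Finset.mul_sum, rootR_sum]
  rw [Finset.sum_eq_single p]
  · simp at hp ⊢; omega
  · intro b hb hbp
    simp only [Finset.mem_Icc] at *
    by_cases h : b ≤ p
    · rw [if_pos (by omega), if_pos (by omega)]; simp
    · rw [if_neg (by omega), if_neg (by omega)]; simp
  · intro h; exact absurd hp h

lemma Cm_sub_U {n m : ℕ} (hm1 : 1 ≤ m) (hm2 : m ≤ n - 1) (hn : 2 ≤ n) :
    Cm n m ⊆ Uset n (n - m) := by
  rintro v ⟨a, h1, h2, h3, rfl⟩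
  refine ⟨?_, ?_, ?_⟩
  · intro j hj
    rw [simple_sum_apply]
    simp only [Finset.mem_Icc] at *
    rw [if_pos (by omega), if_pos (by omega)]
    have := h1 (j-1) (by omega) (by omega)
    rw [Nat.sub_add_cancel (by omega)] at this
    linarith
  · intro j hj
    rw [simple_sum_apply]
    simp only [Finset.mem_Icc, Finset.mem_Ico] at *
    rw [if_pos (by omega), if_pos (by omega)]
    have := h2 (j-1) (by omega) (by omega)
    rw [Nat.sub_add_cancel (by omega)] at this
    linarith
  · rw [simple_partial n a (n-m) (by simp; omega)]
    exact h3

lemma Cm_sub_cone {n m : ℕ} (hm1 : 1 ≤ m) (hm2 : m ≤ n - 1) (hn : 2 ≤ n) :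
    Cm n m ⊆ conePos n := by
  rintro v ⟨a, h1, h2, h3, rfl⟩
  have hd : ∀ d, d < n - m → 0 < a (n - m - d) := by
    intro d
    induction d with
    | zero => intro _; exact h3
    | succ d ih =>
      intro hd
      have := h1 (n - m - (d+1)) (by omega) (by omega)
      have e : n - m - (d+1) + 1 = n - m - d := by omega
      rw [e] at this
      linarith [ih (by omega)]
  have hu : ∀ d, n - m + d ≤ n - 1 → 0 < a (n - m + d) := by
    intro d
    induction d with
    | zero => intro _; exact h3
    | succ d ih =>
      intro hd
      have := h2 (n - m + d) (by omega) (by omega)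
      have := ih (by omega)
      rw [← add_assoc]
      linarith
  have hpos : ∀ i ∈ Finset.Icc 1 (n-1), 0 ≤ a i := by
    intro i hi
    rw [Finset.mem_Icc] at hi
    rcases le_total i (n-m) with h | h
    · have := hd (n - m - i) (by omega)
      rw [show n - m - (n - m - i) = i by omega] at this
      exact this.le
    · have := hu (i - (n-m)) (by omega)
      rw [show n - m + (i - (n - m)) = i by omega] at this
      exact this.le
  obtain ⟨T, hT, _, h⟩ := sum_mem_coneOf n (Finset.Icc 1 (n-1)) (fun i => rootR i (i+1)) a
    (fun i hi => by rw [Finset.mem_Icc] at hi; exact ⟨i, i+1, by omega, by omega, by omega, rfl⟩) hpos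
  exact ⟨T, hT, h⟩

lemma U_sub_Cm {n m : ℕ} (hm1 : 1 ≤ m) (hm2 : m ≤ n - 1) (hn : 2 ≤ n) {v : ℕ → ℝ}
    (hV : inV n v) (hU : v ∈ Uset n (n - m)) : v ∈ Cm n m := by
  obtain ⟨U1, U2, U3⟩ := hU
  refine ⟨fun i => ∑ k ∈ Finset.Icc 1 i, v k, ?_, ?_, U3, ?_⟩
  · intro i h1 h2
    have := U1 (i+1) (by simp only [Finset.mem_Icc]; omega)
    simp only [Finset.sum_Icc_succ_top (show 1 ≤ i + 1 by omega)]
    linarith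
  · intro i h1 h2
    have := U2 (i+1) (by simp only [Finset.mem_Ico]; omega)
    simp only [Finset.sum_Icc_succ_top (show 1 ≤ i + 1 by omega)]
    linarith
  · funext k
    rw [simple_sum_apply]
    simp only [Finset.mem_Icc]
    by_cases hk : k < 1 ∨ n < k
    · rw [hV.1 k hk, if_neg (by omega), if_neg (by omega)]; simp
    · obtain ⟨l, rfl⟩ : ∃ l, k = l + 1 := ⟨k - 1, by omega⟩
      have hs := Finset.sum_Icc_succ_top (show 1 ≤ l + 1 by omega) v
      simp only [Nat.add_sub_cancel]
      by_cases hl : l + 1 = n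
      · have h0 := hV.2
        rw [← hl] at h0
        rw [if_neg (by omega), if_pos (by omega)]
        linarith
      · rw [if_pos (by omega)]
        by_cases h0 : l = 0
        · subst h0; simp
        · rw [if_pos (by omega)]
          linarith

lemma F_regular_sub_U {n p : ℕ} (hp1 : 1 ≤ p) (hp2 : p ≤ n - 1) (hn : 2 ≤ n) {v : ℕ → ℝ}
    (hV : inV n v) (hF : v ∈ Fset n p) (hs : ¬ IsSingular n v) : v ∈ Uset n p := by
  obtain ⟨F1, F2, F3⟩ := hF
  set s := ∑ k ∈ Finset.Icc 1 p, v k with hsdef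
  let c : ℕ → ℝ := fun j => if j ≤ p then - v j else if j < n then v j else s
  let r : ℕ → ℕ → ℝ := fun j => if j ≤ p then rootR 1 j else if j < n then rootR j n else rootR 1 n
  have hc : ∀ j ∈ Finset.Ico 2 (n+1), 0 ≤ c j := by
    intro j hj
    rw [Finset.mem_Ico] at hj
    simp only [c]
    split_ifs with h1 h2
    · have := F1 j (by simp only [Finset.mem_Icc]; omega); linarith
    · exact F2 j (by simp only [Finset.mem_Ico]; omega)
    · exact F3
  have hr : ∀ j ∈ Finset.Ico 2 (n+1), r j ∈ posRoots n := by
    intro j hj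
    rw [Finset.mem_Ico] at hj
    simp only [r]
    split_ifs with h1 h2
    · exact ⟨1, j, by omega, by omega, by omega, rfl⟩
    · exact ⟨j, n, by omega, by omega, by omega, rfl⟩
    · exact ⟨1, n, by omega, by omega, by omega, rfl⟩
  have hv : v = ∑ j ∈ Finset.Ico 2 (n+1), c j • r j := by
    rw [Finset.sum_Ico_succ_top (by omega),
      ← Finset.sum_Ico_consecutive _ (show 2 ≤ p + 1 by omega) (show p + 1 ≤ n by omega)]
    have e1 : ∑ j ∈ Finset.Ico 2 (p+1), c j • r j = ∑ j ∈ Finset.Ico 2 (p+1), (- v j) • rootR 1 j := by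
      refine Finset.sum_congr rfl fun j hj => ?_
      rw [Finset.mem_Ico] at hj
      simp only [c, r, if_pos (show j ≤ p by omega)]
    have e2 : ∑ j ∈ Finset.Ico (p+1) n, c j • r j = ∑ j ∈ Finset.Ico (p+1) n, (v j) • rootR j n := by
      refine Finset.sum_congr rfl fun j hj => ?_
      rw [Finset.mem_Ico] at hj
      simp only [c, r, if_neg (show ¬ j ≤ p by omega), if_pos (show j < n by omega)]
    have e3 : c n • r n = s • rootR 1 n := by
      simp only [c, r, if_neg (show ¬ n ≤ p by omega), if_neg (show ¬ n < n by omega)]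
    rw [e1, e2, e3]
    have s1 : s = v 1 + ∑ j ∈ Finset.Ico 2 (p+1), v j := by
      rw [hsdef, ← Finset.sum_eq_sum_Ico_succ_bot (by omega)]; rfl
    have s2 : s + ∑ j ∈ Finset.Ico (p+1) n, v j + v n = 0 := by
      have h0 := hV.2
      have : ∑ k ∈ Finset.Icc 1 n, v k = ∑ k ∈ Finset.Ico 1 (n+1), v k := rfl
      rw [this, Finset.sum_Ico_succ_top (by omega),
        ← Finset.sum_Ico_consecutive _ (show 1 ≤ p + 1 by omega) (show p + 1 ≤ n by omega)] at h0
      exact h0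
    funext k
    simp only [Pi.add_apply, Finset.sum_apply, Pi.smul_apply, smul_eq_mul, rootR, mul_sub,
      Finset.sum_sub_distrib, mul_ite, mul_one, mul_zero, Finset.sum_ite_eq]
    by_cases k1 : k = 1
    · subst k1
      have : (1:ℕ) ≠ n := by omega
      simp [this]
      rw [if_neg (by omega)]
      linarith
    · by_cases kn : k = n
      · subst kn
        simp [k1]
        rw [if_neg (by omega)]
        linarith
      · simp only [if_neg k1, if_neg kn, Finset.mem_Ico]
        simp only [Finset.sum_const_zero]
        by_cases hk : k < 1 ∨ n < k
        · rw [hV.1 k hk]; simp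
        · by_cases hk2 : k ≤ p
          · rw [if_pos (by omega), if_neg (by omega)]; ring
          · rw [if_neg (by omega), if_pos (by omega)]; ring
  have hne : ∀ j ∈ Finset.Ico 2 (n+1), c j ≠ 0 := by
    intro j hj h0
    apply hs
    obtain ⟨T, hT, hcard, h⟩ := sum_mem_coneOf n ((Finset.Ico 2 (n+1)).erase j) r c
      (fun i hi => hr i (Finset.mem_of_mem_erase hi)) (fun i hi => hc i (Finset.mem_of_mem_erase hi))
    refine ⟨T, hT, ?_, ?_⟩
    · rw [Finset.card_erase_of_mem hj, Nat.card_Ico] at hcard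
      omega
    · rw [Finset.sum_erase _ (by rw [h0, zero_smul]), ← hv] at h
      exact h
  have hpos : ∀ j ∈ Finset.Ico 2 (n+1), 0 < c j := fun j hj =>
    lt_of_le_of_ne (hc j hj) (hne j hj).symm
  refine ⟨?_, ?_, ?_⟩
  · intro j hj
    rw [Finset.mem_Icc] at hj
    have := hpos j (by rw [Finset.mem_Ico]; omega)
    simp only [c, if_pos hj.2] at this
    linarith
  · intro j hj
    rw [Finset.mem_Ico] at hj
    have := hpos j (by rw [Finset.mem_Ico]; omega)
    simpa only [c, if_neg (show ¬ j ≤ p by omega), if_pos hj.2] using this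
  · have := hpos n (by rw [Finset.mem_Ico]; omega)
    simpa only [c, if_neg (show ¬ n ≤ p by omega), if_neg (show ¬ n < n by omega)] using this

lemma Cm_convex (n m : ℕ) : Convex ℝ (Cm n m) := by
  rintro x ⟨a, a1, a2, a3, rfl⟩ y ⟨b, b1, b2, b3, rfl⟩ s t hs ht hst
  have key : ∀ {p q p' q' : ℝ}, p < q → p' < q' → s * p + t * p' < s * q + t * q' := by
    intro p q p' q' h h'
    rcases hs.eq_or_lt with h0 | h0
    · have : t = 1 := by linarith
      subst this; rw [← h0]; linarith
    · nlinarith [mul_lt_mul_of_pos_left h h0, mul_le_mul_of_nonneg_left h'.le ht]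
  refine ⟨fun i => s * a i + t * b i, fun i h1 h2 => key (a1 i h1 h2) (b1 i h1 h2),
    fun i h1 h2 => key (a2 i h1 h2) (b2 i h1 h2), ?_, ?_⟩
  · have := key a3 b3
    simpa using this
  · simp only [Finset.smul_sum, ← Finset.sum_add_distrib, smul_smul, add_smul]

theorem Cm_is_big_chamber (n m : ℕ) (hn : 2 ≤ n) (hm1 : 1 ≤ m) (hm2 : m ≤ n - 1) :
    ∃ x ∈ Cm n m, connectedComponentIn (regularSet n) x = Cm n m := by
  have hsub : Cm n m ⊆ regularSet n := fun v hv =>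
    ⟨Cm_sub_cone hm1 hm2 hn hv, not_singular (by omega) (by omega) hn (Cm_sub_U hm1 hm2 hn hv)⟩
  have hne : ∃ x, x ∈ Cm n m := by
    refine ⟨_, fun i => 1 + |(i:ℝ) - ((n - m : ℕ) : ℝ)|, ?_, ?_, ?_, rfl⟩
    · intro i h1 h2
      have : ((i:ℝ) + 1) ≤ ((n - m : ℕ) : ℝ) := by exact_mod_cast h2
      push_cast [-Nat.cast_sub]
      rw [abs_of_nonpos (by linarith), abs_of_nonpos (by linarith)]
      linarith
    · intro i h1 h2
      have : ((n - m : ℕ) : ℝ) ≤ (i:ℝ) := by exact_mod_cast h1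
      push_cast [-Nat.cast_sub]
      rw [abs_of_nonneg (by linarith), abs_of_nonneg (by linarith)]
      linarith
    · positivity
  obtain ⟨x, hx⟩ := hne
  refine ⟨x, hx, Set.Subset.antisymm ?_ ?_⟩
  · have hX : connectedComponentIn (regularSet n) x ⊆ regularSet n := connectedComponentIn_subset _ _
    have hXU : connectedComponentIn (regularSet n) x ⊆ Uset n (n - m) := by
      refine IsPreconnected.subset_left_of_subset_union (Uset_open n (n-m))
        (Fset_closed n (n-m)).isOpen_compl ?_ ?_ ?_ isPreconnected_connectedComponentIn
      · exact Set.disjoint_left.2 fun v h h' => h' (Uset_sub_Fset _ _ h)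
      · intro v hv
        by_cases hF : v ∈ Fset n (n-m)
        · exact Or.inl (F_regular_sub_U (by omega) (by omega) hn (conePos_inV (hX hv).1) hF (hX hv).2)
        · exact Or.inr hF
      · exact ⟨x, mem_connectedComponentIn (hsub hx), Cm_sub_U hm1 hm2 hn hx⟩
    intro v hv
    exact U_sub_Cm hm1 hm2 hn (conePos_inV (hX hv).1) (hXU hv)
  · exact (Cm_convex n m).isPreconnected.subset_connectedComponentIn hx hsub
end

section
/- Let n ≥ 3. Then W^{dec}({1,…,n}) = W^{dec}({1,…,n−1}) ∪ { u∘w₀ : u ∈ W^{dec}({1,…,n−1}) }, where W^{dec}({1,…,n−1}) is viewed inside the permutations of {1,…,n} fixing n, and w₀ is the longest element of S_n. -/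
/-- The longest element of the symmetric group on the interval `{a, …, b}`,
viewed as a permutation of `ℕ` fixing everything else. -/
def wLong (a b : ℕ) : Equiv.Perm ℕ :=
  Function.Involutive.toPerm (fun k => if a ≤ k ∧ k ≤ b then a + b - k else k)
    (by intro k; dsimp only; split_ifs <;> omega)

/-- `|w(α_i)|`: whichever of `±(e_{w(i)} − e_{w(i+1)})` is a positive root. -/
noncomputable def absRoot (w : Equiv.Perm ℕ) (i : ℕ) : ℕ → ℝ :=
  rootR (min (w i) (w (i + 1))) (max (w i) (w (i + 1)))

/-- Permutations of `{a, …, b}`: permutations of `ℕ` fixing every element outside `[a,b]`. -/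
def SB (a b : ℕ) : Set (Equiv.Perm ℕ) := {w | ∀ k ∉ Finset.Icc a b, w k = k}

/-- The cone generated by the positive roots `|w(α_i)|`, `a ≤ i ≤ b − 1`. -/
noncomputable def ConeB (a b : ℕ) (w : Equiv.Perm ℕ) : Set (ℕ → ℝ) :=
  {v | ∃ c : ℕ → ℝ, (∀ i ∈ Finset.Icc a (b - 1), 0 ≤ c i) ∧
      v = ∑ i ∈ Finset.Icc a (b - 1), c i • absRoot w i}

/-- Vectors `Σ_{i=a}^{b−1} c_i α_i` with `c_a > c_{a+1} > ⋯ > c_{b−1} > 0`. -/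
def decSet (a b : ℕ) : Set (ℕ → ℝ) :=
  {v | ∃ c : ℕ → ℝ, (∀ i, a ≤ i → i + 1 ≤ b - 1 → c (i + 1) < c i) ∧ 0 < c (b - 1) ∧
      v = ∑ i ∈ Finset.Icc a (b - 1), c i • rootR i (i + 1)}

/-- Vectors `Σ_{i=a}^{b−1} c_i α_i` with `0 < c_a < c_{a+1} < ⋯ < c_{b−1}`. -/
def incSet (a b : ℕ) : Set (ℕ → ℝ) :=
  {v | ∃ c : ℕ → ℝ, 0 < c a ∧ (∀ i, a ≤ i → i + 1 ≤ b - 1 → c i < c (i + 1)) ∧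
      v = ∑ i ∈ Finset.Icc a (b - 1), c i • rootR i (i + 1)}

def Wdec (a b : ℕ) : Set (Equiv.Perm ℕ) := {w | w ∈ SB a b ∧ decSet a b ⊆ ConeB a b w}

def Winc (a b : ℕ) : Set (Equiv.Perm ℕ) := {w | w ∈ SB a b ∧ incSet a b ⊆ ConeB a b w}

/-- `W^m`: permutations of `{1,…,n}` whose cone contains `C_m`. -/
def Wm (n m : ℕ) : Set (Equiv.Perm ℕ) := {w | w ∈ SB 1 n ∧ Cm n m ⊆ ConeB 1 n w}

theorem aux_absRoot (w : Equiv.Perm ℕ) (i : ℕ) :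
    absRoot w i = (if w i < w (i + 1) then (1:ℝ) else -1) • rootR (w i) (w (i + 1)) := by
  unfold absRoot
  split_ifs with h
  · rw [min_eq_left h.le, max_eq_right h.le, one_smul]
  · rw [min_eq_right (not_lt.mp h), max_eq_left (not_lt.mp h)]
    funext k
    simp [rootR]

theorem aux_phi (w : Equiv.Perm ℕ) (i l : ℕ) (hi : 1 ≤ i) (hl : 1 ≤ l) :
    ∑ j ∈ Finset.Icc 1 i, rootR (w l) (w (l + 1)) (w j) = if l = i then 1 else 0 := by
  simp only [rootR, Finset.sum_sub_distrib, EmbeddingLike.apply_eq_iff_eq, Finset.sum_ite_eq',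
    Finset.mem_Icc]
  split_ifs <;> first | omega | norm_num

theorem aux_coef (w : Equiv.Perm ℕ) (m i : ℕ) (t : ℕ → ℝ) (hi : 1 ≤ i) :
    ∑ j ∈ Finset.Icc 1 i, (∑ l ∈ Finset.Icc 1 (m - 1), t l • rootR (w l) (w (l + 1))) (w j)
      = if i ≤ m - 1 then t i else 0 := by
  simp only [Finset.sum_apply, Pi.smul_apply, smul_eq_mul]
  rw [Finset.sum_comm]
  have : ∀ l ∈ Finset.Icc 1 (m - 1), ∑ j ∈ Finset.Icc 1 i, t l * rootR (w l) (w (l + 1)) (w j)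
      = if l = i then t l else 0 := by
    intro l hl
    rw [← Finset.mul_sum, aux_phi w i l hi (Finset.mem_Icc.mp hl).1]
    split_ifs <;> simp
  rw [Finset.sum_congr rfl this, Finset.sum_ite_eq']
  simp [hi]

theorem aux_abel (w : Equiv.Perm ℕ) (f : ℕ → ℝ) (k m : ℕ) :
    ∑ i ∈ Finset.Icc 1 m, (∑ j ∈ Finset.Icc 1 i, f j) * rootR (w i) (w (i + 1)) k
      = ∑ i ∈ Finset.Icc 1 (m + 1), f i * (if k = w i then 1 else 0)
        - (∑ j ∈ Finset.Icc 1 (m + 1), f j) * (if k = w (m + 1) then 1 else 0) := by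
  induction m with
  | zero => simp
  | succ m ih =>
    rw [Finset.sum_Icc_succ_top (by omega), ih,
      Finset.sum_Icc_succ_top (b := m + 1) (f := fun i => f i * (if k = w i then 1 else 0)) (by omega),
      Finset.sum_Icc_succ_top (b := m + 1) (f := f) (by omega)]
    simp only [rootR]
    ring

theorem aux_dec {m : ℕ} (hm : 2 ≤ m) {v : ℕ → ℝ} (hv : v ∈ decSet 1 m) :
    0 < v 1 ∧ (∀ k, 2 ≤ k → k ≤ m → v k < 0) ∧ (∀ k, k ∉ Finset.Icc 1 m → v k = 0) ∧
      ∑ j ∈ Finset.Icc 1 m, v j = 0 := by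
  obtain ⟨c, h1, h2, rfl⟩ := hv
  have key := fun i hi => aux_coef 1 m i c hi
  simp only [Equiv.Perm.coe_one, id] at key
  set v := ∑ i ∈ Finset.Icc 1 (m - 1), c i • rootR i (i + 1) with hv
  have hpos : ∀ d, d ≤ m - 2 → 0 < c (m - 1 - d) := by
    intro d
    induction d with
    | zero => intro _; simpa using h2
    | succ d ih =>
      intro hd
      have := h1 (m - 1 - (d + 1)) (by omega) (by omega)
      rw [show m - 1 - (d + 1) + 1 = m - 1 - d by omega] at this
      exact (ih (by omega)).trans this
  refine ⟨?_, ?_, ?_, ?_⟩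
  · have := key 1 le_rfl
    rw [if_pos (by omega)] at this
    simp only [Finset.Icc_self, Finset.sum_singleton] at this
    rw [this]
    have := hpos (m - 2) le_rfl
    rwa [show m - 1 - (m - 2) = 1 by omega] at this
  · intro k hk hkm
    obtain ⟨k, rfl⟩ : ∃ k', k = k' + 1 := ⟨k - 1, by omega⟩
    have e1 := key k (by omega)
    have e2 := key (k + 1) (by omega)
    rw [Finset.sum_Icc_succ_top (by omega), e1, if_pos (by omega)] at e2
    split_ifs at e2 with h
    · have := h1 k (by omega) h
      linarith
    · have : k = m - 1 := by omega
      subst this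
      linarith
  · intro k hk
    rw [hv, Finset.sum_apply]
    apply Finset.sum_eq_zero
    intro i hi
    simp only [Finset.mem_Icc] at hi hk
    simp only [Pi.smul_apply, rootR, smul_eq_mul]
    rw [if_neg (by omega), if_neg (by omega)]
    simp
  · rw [key m (by omega), if_neg (by omega)]

theorem aux_SB_mem {m : ℕ} {w : Equiv.Perm ℕ} (hw : w ∈ SB 1 m) (k : ℕ) :
    w k ∈ Finset.Icc 1 m ↔ k ∈ Finset.Icc 1 m := by
  constructor
  · intro h
    by_contra hk
    rw [hw k hk] at h
    exact hk h
  · intro h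
    by_contra hk
    have := w.injective (hw (w k) hk)
    rw [this] at hk
    exact hk h

theorem aux_sum_perm {m : ℕ} {w : Equiv.Perm ℕ} (hw : w ∈ SB 1 m) (f : ℕ → ℝ) :
    ∑ j ∈ Finset.Icc 1 m, f (w j) = ∑ j ∈ Finset.Icc 1 m, f j :=
  Finset.sum_equiv w (fun i => (aux_SB_mem hw i).symm) (fun _ _ => rfl)

theorem aux_sign {m : ℕ} (hm : 2 ≤ m) {v : ℕ → ℝ} (hv : v ∈ decSet 1 m) {w : Equiv.Perm ℕ}
    (hw : w ∈ SB 1 m) {p : ℕ} (hp : w p = 1) {i : ℕ} (hi : 1 ≤ i) (him : i ≤ m - 1) :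
    (p ≤ i → 0 < ∑ j ∈ Finset.Icc 1 i, v (w j)) ∧
    (i < p → ∑ j ∈ Finset.Icc 1 i, v (w j) < 0) := by
  obtain ⟨-, hneg, -, hsum⟩ := aux_dec hm hv
  have hneg' : ∀ j, 1 ≤ j → j ≤ m → j ≠ p → v (w j) < 0 := by
    intro j h1 h2 h3
    have := (aux_SB_mem hw j).mpr (Finset.mem_Icc.mpr ⟨h1, h2⟩)
    rw [Finset.mem_Icc] at this
    have h4 : w j ≠ 1 := fun h => h3 (w.injective (h.trans hp.symm))
    exact hneg _ (by omega) this.2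
  constructor
  · intro h
    rw [← aux_sum_perm hw v] at hsum
    have hsplit : ∑ j ∈ Finset.Icc 1 m, v (w j) =
        ∑ j ∈ Finset.Icc 1 i, v (w j) + ∑ j ∈ Finset.Icc (i + 1) m, v (w j) := by
      rw [← Finset.sum_union]
      · congr 1
        ext x
        simp only [Finset.mem_union, Finset.mem_Icc]
        omega
      · rw [Finset.disjoint_left]
        intro x
        simp only [Finset.mem_Icc]
        omega
    have : ∑ j ∈ Finset.Icc (i + 1) m, v (w j) < 0 := by
      apply Finset.sum_neg
      · intro j hj
        rw [Finset.mem_Icc] at hj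
        exact hneg' j (by omega) hj.2 (by omega)
      · exact ⟨m, Finset.mem_Icc.mpr ⟨by omega, le_rfl⟩⟩
    linarith
  · intro h
    apply Finset.sum_neg
    · intro j hj
      rw [Finset.mem_Icc] at hj
      exact hneg' j (by omega) (by omega) (by omega)
    · exact ⟨1, Finset.mem_Icc.mpr ⟨le_rfl, hi⟩⟩

/-- V-shaped. -/
def VShape (m : ℕ) (w : Equiv.Perm ℕ) : Prop :=
  ∃ p, w p = 1 ∧ ∀ i, 1 ≤ i → i ≤ m - 1 → (w i < w (i + 1) ↔ p ≤ i)

theorem aux_decSet_nonempty (m : ℕ) (hm : 2 ≤ m) : (decSet 1 m).Nonempty := by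
  refine ⟨_, fun i => (m : ℝ) - i, ?_, ?_, rfl⟩
  · intro i _ _
    push_cast
    linarith
  · have : ((m - 1 : ℕ) : ℝ) < m := by exact_mod_cast (by omega : m - 1 < m)
    simp only
    linarith

theorem aux_Wdec (m : ℕ) (hm : 2 ≤ m) (w : Equiv.Perm ℕ) :
    w ∈ Wdec 1 m ↔ w ∈ SB 1 m ∧ VShape m w := by
  constructor
  · rintro ⟨hw, hsub⟩
    refine ⟨hw, w.symm 1, by simp, ?_⟩
    intro i hi him
    obtain ⟨v, hv⟩ := aux_decSet_nonempty m hm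
    obtain ⟨h1, h2⟩ := aux_sign hm hv hw (p := w.symm 1) (by simp) hi him
    obtain ⟨c, hc, hvc⟩ := hsub hv
    have := aux_coef w m i (fun l => c l * (if w l < w (l + 1) then (1:ℝ) else -1)) hi
    simp only [mul_smul, ← aux_absRoot, ← hvc, if_pos him] at this
    rw [this] at h1 h2
    have hci := hc i (Finset.mem_Icc.mpr ⟨hi, him⟩)
    constructor
    · intro h
      by_contra hn
      have := h2 (by omega)
      rw [if_pos h] at this
      linarith
    · intro h
      by_contra hn
      have := h1 h
      rw [if_neg hn] at this
      linarith
  · rintro ⟨hw, p, hp, hV⟩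
    refine ⟨hw, ?_⟩
    intro v hv
    refine ⟨fun i => |∑ j ∈ Finset.Icc 1 i, v (w j)|, fun i _ => abs_nonneg _, ?_⟩
    have e : ∀ i ∈ Finset.Icc 1 (m - 1), |∑ j ∈ Finset.Icc 1 i, v (w j)| • absRoot w i =
        (∑ j ∈ Finset.Icc 1 i, v (w j)) • rootR (w i) (w (i + 1)) := by
      intro i hi
      rw [Finset.mem_Icc] at hi
      obtain ⟨h1, h2⟩ := aux_sign hm hv hw hp hi.1 hi.2
      rw [aux_absRoot, smul_smul]
      congr 1
      by_cases h : p ≤ i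
      · rw [if_pos ((hV i hi.1 hi.2).mpr h), abs_of_pos (h1 h), mul_one]
      · rw [if_neg (fun h' => h ((hV i hi.1 hi.2).mp h')), abs_of_neg (h2 (by omega))]
        ring
    rw [Finset.sum_congr rfl e]
    obtain ⟨-, -, hout, hsum⟩ := aux_dec hm hv
    funext k
    rw [Finset.sum_apply]
    simp only [Pi.smul_apply, smul_eq_mul]
    rw [aux_abel w (fun j => v (w j)) k (m - 1), show m - 1 + 1 = m by omega, aux_sum_perm hw v,
      hsum, aux_sum_perm hw (fun x => v x * (if k = x then 1 else 0))]
    simp only [mul_ite, mul_one, mul_zero, Finset.sum_ite_eq, zero_mul, ite_self, sub_zero]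
    split_ifs with h
    · rfl
    · exact hout k h

theorem aux_wLong (n k : ℕ) : wLong 1 n k = if 1 ≤ k ∧ k ≤ n then 1 + n - k else k := rfl

theorem aux_rev_SB {n : ℕ} {w : Equiv.Perm ℕ} (hw : w ∈ SB 1 n) : w * wLong 1 n ∈ SB 1 n := by
  intro k hk
  have hk' := hk
  rw [Finset.mem_Icc] at hk'
  rw [Equiv.Perm.mul_apply, aux_wLong, if_neg hk', hw k hk]

theorem aux_rev_V {n : ℕ} {w : Equiv.Perm ℕ} (hw : w ∈ SB 1 n) (hn : 3 ≤ n) (hV : VShape n w) :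
    VShape n (w * wLong 1 n) := by
  obtain ⟨p, hp, hV⟩ := hV
  have hpm := (aux_SB_mem hw p).mp (by rw [hp, Finset.mem_Icc]; omega)
  rw [Finset.mem_Icc] at hpm
  refine ⟨1 + n - p, ?_, ?_⟩
  · rw [Equiv.Perm.mul_apply, aux_wLong, if_pos (by omega),
      show 1 + n - (1 + n - p) = p by omega, hp]
  · intro i h1 h2
    rw [Equiv.Perm.mul_apply, Equiv.Perm.mul_apply, aux_wLong, aux_wLong, if_pos (by omega),
      if_pos (by omega)]
    have := hV (n - i) (by omega) (by omega)
    have hne : w (n - i) ≠ w (n - i + 1) := fun h => by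
      have := w.injective h
      omega
    rw [show 1 + n - i = n - i + 1 by omega, show 1 + n - (i + 1) = n - i by omega]
    omega

theorem aux_rev_rev (n : ℕ) (w : Equiv.Perm ℕ) : w * wLong 1 n * wLong 1 n = w := by
  ext k
  rw [Equiv.Perm.mul_apply, Equiv.Perm.mul_apply, aux_wLong, aux_wLong]
  congr 1
  split_ifs <;> omega

theorem aux_top {n : ℕ} (hn : 3 ≤ n) (w : Equiv.Perm ℕ) :
    (w ∈ SB 1 (n - 1) ∧ VShape (n - 1) w) ↔ (w ∈ SB 1 n ∧ VShape n w ∧ w n = n) := by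
  constructor
  · rintro ⟨hw, p, hp, hV⟩
    have hwn : w n = n := hw n (by rw [Finset.mem_Icc]; omega)
    have hpm := (aux_SB_mem hw p).mp (by rw [hp, Finset.mem_Icc]; omega)
    rw [Finset.mem_Icc] at hpm
    refine ⟨fun k hk => hw k ?_, ⟨p, hp, ?_⟩, hwn⟩
    · rw [Finset.mem_Icc] at hk ⊢
      omega
    · intro i h1 h2
      by_cases h : i ≤ n - 1 - 1
      · exact hV i h1 h
      · have hi : i = n - 1 := by omega
        have := (aux_SB_mem hw i).mpr (by rw [Finset.mem_Icc]; omega)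
        rw [Finset.mem_Icc] at this
        rw [show i + 1 = n by omega, hwn]
        omega
  · rintro ⟨hw, ⟨p, hp, hV⟩, hwn⟩
    refine ⟨fun k hk => ?_, p, hp, fun i h1 h2 => hV i h1 (by omega)⟩
    by_cases h : k = n
    · rw [h, hwn]
    · apply hw
      rw [Finset.mem_Icc] at hk ⊢
      omega

theorem aux_ends {n : ℕ} (hn : 3 ≤ n) {w : Equiv.Perm ℕ} (hw : w ∈ SB 1 n) (hV : VShape n w) :
    w n = n ∨ w 1 = n := by
  obtain ⟨p, hp, hV⟩ := hV
  obtain ⟨q, hq⟩ := w.surjective n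
  have hqm := (aux_SB_mem hw q).mp (by rw [hq, Finset.mem_Icc]; omega)
  rw [Finset.mem_Icc] at hqm
  by_contra hcon
  have q1 : q ≠ n := by rintro rfl; exact hcon (Or.inl hq)
  have q2 : q ≠ 1 := by rintro rfl; exact hcon (Or.inr hq)
  have a1 := (aux_SB_mem hw (q - 1)).mpr (by rw [Finset.mem_Icc]; omega)
  have a2 := (aux_SB_mem hw (q + 1)).mpr (by rw [Finset.mem_Icc]; omega)
  rw [Finset.mem_Icc] at a1 a2
  have h1 := hV (q - 1) (by omega) (by omega)
  have h2 := hV q (by omega) (by omega)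
  have hne : w (q - 1) ≠ w q := fun h => by
    have := w.injective h
    omega
  rw [show q - 1 + 1 = q by omega] at h1
  omega

theorem Wdec_inductive_description (n : ℕ) (hn : 3 ≤ n) :
    Wdec 1 n = Wdec 1 (n - 1) ∪ (fun u => u * wLong 1 n) '' Wdec 1 (n - 1) := by
  ext w
  simp only [Set.mem_union, Set.mem_image]
  simp only [aux_Wdec n (by omega), aux_Wdec (n - 1) (by omega), aux_top hn]
  constructor
  · rintro ⟨hw, hV⟩
    rcases aux_ends hn hw hV with h | h
    · exact Or.inl ⟨hw, hV, h⟩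
    · refine Or.inr ⟨w * wLong 1 n, ⟨aux_rev_SB hw, aux_rev_V hw hn hV, ?_⟩, aux_rev_rev n w⟩
      rw [Equiv.Perm.mul_apply, aux_wLong, if_pos (by omega), show 1 + n - n = 1 by omega, h]
  · rintro (⟨hw, hV, -⟩ | ⟨u, ⟨hu, hV, -⟩, rfl⟩)
    · exact ⟨hw, hV⟩
    · exact ⟨aux_rev_SB hu, aux_rev_V hu hn hV⟩
end

section
/- Let n ≥ 2 and let w ∈ W^{dec}({1,…,n}). Then w(n) = n or w(1) = n. -/
lemma dec_coord (n : ℕ) (k : ℕ) (h2 : 2 ≤ k) (hk : k ≤ n) :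
    (∑ i ∈ Finset.Icc 1 (n - 1), ((n : ℝ) - i) • rootR i (i + 1)) k = -1 := by
  have e : ∀ i : ℕ, (k = i + 1) ↔ (k - 1 = i) := by intro i; omega
  simp only [Finset.sum_apply, Pi.smul_apply, rootR, smul_eq_mul, mul_sub,
    Finset.sum_sub_distrib, mul_ite, mul_one, mul_zero, e, Finset.sum_ite_eq, Finset.mem_Icc]
  have h1 : 1 ≤ k - 1 ∧ k - 1 ≤ n - 1 := by omega
  rw [if_pos h1]
  have hc : ((k - 1 : ℕ) : ℝ) = k - 1 := by
    rw [Nat.cast_sub (by omega)]; simp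
  rw [hc]
  split_ifs with h
  · ring
  · have : k = n := by omega
    subst this; ring

lemma sum_rootR (S : Finset ℕ) (a b : ℕ) :
    ∑ k ∈ S, rootR a b k = (if a ∈ S then 1 else 0) - (if b ∈ S then 1 else 0) := by
  simp [rootR, Finset.sum_sub_distrib]

lemma no_set (n : ℕ) (hn : 2 ≤ n) (w : Equiv.Perm ℕ) (hw : w ∈ Wdec 1 n)
    (S : Finset ℕ) (hS : S.Nonempty) (hs : ∀ k ∈ S, 2 ≤ k ∧ k ≤ n)
    (h : ∀ i, 1 ≤ i → i ≤ n - 1 → max (w i) (w (i+1)) ∈ S → min (w i) (w (i+1)) ∈ S) :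
    False := by
  have hv : (∑ i ∈ Finset.Icc 1 (n - 1), ((n : ℝ) - i) • rootR i (i + 1)) ∈ decSet 1 n := by
    refine ⟨fun i => (n : ℝ) - i, ?_, ?_, rfl⟩
    · intro i _ _; push_cast; linarith
    · have : ((n - 1 : ℕ) : ℝ) < n := by exact_mod_cast (by omega : n - 1 < n)
      simpa using this
  obtain ⟨c, hc, he⟩ := hw.2 hv
  have h1 : ∑ k ∈ S, (∑ i ∈ Finset.Icc 1 (n - 1), ((n : ℝ) - i) • rootR i (i + 1)) k < 0 := by
    apply Finset.sum_neg _ hS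
    intro k hk
    rw [dec_coord n k (hs k hk).1 (hs k hk).2]
    norm_num
  rw [he] at h1
  simp only [Finset.sum_apply, Pi.smul_apply, smul_eq_mul] at h1
  rw [Finset.sum_comm] at h1
  refine absurd h1 (not_lt.mpr (Finset.sum_nonneg ?_))
  intro i hi
  rw [← Finset.mul_sum]
  refine mul_nonneg (hc i hi) ?_
  rw [Finset.mem_Icc] at hi
  have := h i hi.1 hi.2
  rw [absRoot, sum_rootR]
  split_ifs <;> simp_all

theorem Wdec_endpoint (n : ℕ) (hn : 2 ≤ n) (w : Equiv.Perm ℕ) (hw : w ∈ Wdec 1 n) :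
    w n = n ∨ w 1 = n := by
  by_contra hcon
  push Not at hcon
  obtain ⟨hn', h1'⟩ := hcon
  have hfix : ∀ k, ¬ (1 ≤ k ∧ k ≤ n) → w k = k := fun k hk => hw.1 k (by simpa using hk)
  have hmem : ∀ k, 1 ≤ k → k ≤ n → 1 ≤ w k ∧ w k ≤ n := by
    intro k h1 h2
    by_contra hc
    have := w.injective (hfix _ hc)
    omega
  have hinv : ∀ k, 1 ≤ k → k ≤ n → ∃ m, 1 ≤ m ∧ m ≤ n ∧ w m = k := by
    intro k h1 h2
    obtain ⟨m, hm⟩ := w.surjective k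
    refine ⟨m, ?_⟩
    by_contra hc
    have := hfix m (by omega)
    omega
  obtain ⟨m, hm1, hm2, hm⟩ := hinv n (by omega) le_rfl
  obtain ⟨q, hq1, hq2, hq⟩ := hinv 1 le_rfl (by omega)
  have hmn : m ≠ n := by rintro rfl; exact hn' hm
  have hm1' : m ≠ 1 := by rintro rfl; exact h1' hm
  have hqm : q ≠ m := by rintro rfl; omega
  have key : ∀ a b : ℕ, 1 ≤ a → a ≤ b → b ≤ n → (q < a ∨ b < q) →
      (∀ i, 1 ≤ i → i ≤ n - 1 → (i + 1 = a ∨ i = b) → w i = n ∨ w (i+1) = n) →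
      (m < a ∨ b < m) → False := by
    intro a b ha hab hb hqab hi hmab
    refine no_set n hn w hw ((Finset.Icc a b).image w) (by simpa using hab) ?_ ?_
    · intro k hk
      obtain ⟨j, hj, rfl⟩ := Finset.mem_image.1 hk
      rw [Finset.mem_Icc] at hj
      have := hmem j (by omega) (by omega)
      have : w j ≠ 1 := fun h => by
        have := w.injective (h.trans hq.symm)
        omega
      omega
    · intro i hi1 hi2
      have hI : ∀ j, w j ∈ (Finset.Icc a b).image w ↔ a ≤ j ∧ j ≤ b := by
        intro j; simp
      have ei : w i = n → i = m := fun h => w.injective (h.trans hm.symm)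
      have ei1 : w (i+1) = n → i + 1 = m := fun h => w.injective (h.trans hm.symm)
      have b1 := hmem i (by omega) (by omega)
      have b2 := hmem (i+1) (by omega) (by omega)
      have hi' := hi i hi1 hi2
      rcases le_total (w i) (w (i+1)) with hl | hl
      · rw [max_eq_right hl, min_eq_left hl, hI, hI]
        intro h
        by_contra hc
        rcases hi' (by omega) with h' | h'
        · have := ei1 (by omega)
          have := ei h'
          omega
        · have := ei1 h'
          omega
      · rw [max_eq_left hl, min_eq_right hl, hI, hI]
        intro h
        by_contra hc
        rcases hi' (by omega) with h' | h'
        · have := ei h'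
          omega
        · have := ei (by omega)
          have := ei1 h'
          omega
  rcases lt_or_gt_of_ne hqm with hlt | hgt
  · refine key (m+1) n (by omega) (by omega) le_rfl (by omega) ?_ (by omega)
    intro i _ _ h
    left
    have : i = m := by omega
    rw [this, hm]
  · refine key 1 (m-1) le_rfl (by omega) (by omega) (by omega) ?_ (by omega)
    intro i _ _ h
    right
    have : i + 1 = m := by omega
    rw [this, hm]
end

section
/- Let n ≥ 3, let a_1 > a_2 > ⋯ > a_n > 0 be integers, and set λ := Σ_{i=1}^{n} a_i α_i and λ′ := Σ_{i=1}^{n−1} a_i α_i. Then for every w ∈ W^{dec}({1,…,n−1}) the following four identities hold in ℚ(q): (1) (−1)^{ε_{n+1}(w)} q^{−D(w,λ)} = (−1)^{ε_n(w)+1} q^{−D(w,λ′)} · q^{−a_n}; (2) (−1)^{ε_{n+1}(w∘u)} q^{−D(w∘u,λ)} = (−1)^{ε_n(w∘v)} q^{−D(w∘v,λ′)} · q^{a_n}; (3) (−1)^{ε_{n+1}(w∘v)} q^{−D(w∘v,λ)} = (−1)^{ε_n(w∘v)+1} q^{−D(w∘v,λ′)} · q^{−n·a_n}; (4) (−1)^{ε_{n+1}(w∘v∘u)}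 q^{−D(w∘v∘u,λ)} = (−1)^{ε_n(w)} q^{−D(w,λ′)} · q^{n·a_n}. -/
noncomputable def q : RatFunc ℚ := RatFunc.X

/-- `ε_k(x) = #{i ∈ {1,…,k−1} : x(i) < x(i+1)}`. -/
def eps (k : ℕ) (x : Equiv.Perm ℕ) : ℕ :=
  ((Finset.Icc 1 (k - 1)).filter fun i => x i < x (i + 1)).card

/-- `D(x, Σ_{i ∈ s} c_i α_i) = Σ_{i ∈ s} c_i (x⁻¹(i+1) − x⁻¹(i))`. -/
def Dg (s : Finset ℕ) (x : Equiv.Perm ℕ) (c : ℕ → ℤ) : ℤ :=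
  ∑ i ∈ s, c i * ((x⁻¹ (i + 1) : ℤ) - (x⁻¹ i : ℤ))

theorem eps_sum (m : ℕ) (x : Equiv.Perm ℕ) :
    eps (m + 1) x = ∑ i ∈ Finset.range m, if x (i + 1) < x (i + 2) then 1 else 0 := by
  induction m with
  | zero => simp [eps]
  | succ m ih =>
    rw [Finset.sum_range_succ, ← ih]
    unfold eps
    rw [show m + 1 + 1 - 1 = m + 1 by omega, show m + 1 - 1 = m by omega,
      ← Finset.insert_Icc_right_eq_Icc_add_one (by omega), Finset.filter_insert]
    split_ifs
    · rw [Finset.card_insert_of_notMem (by simp)]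
    · simp

theorem eps_top (n : ℕ) (hn : 1 ≤ n) (x : Equiv.Perm ℕ) (h : x n < x (n + 1)) :
    eps (n + 1) x = eps n x + 1 := by
  obtain ⟨m, rfl⟩ : ∃ m, n = m + 1 := ⟨n - 1, by omega⟩
  rw [eps_sum, eps_sum, Finset.sum_range_succ, if_pos h]

theorem eps_shift (n : ℕ) (hn : 1 ≤ n) (x y : Equiv.Perm ℕ) (h : ¬ x 1 < x 2)
    (hxy : ∀ i, 1 ≤ i → i ≤ n → x (i + 1) = y i) :
    eps (n + 1) x = eps n y := by
  obtain ⟨m, rfl⟩ : ∃ m, n = m + 1 := ⟨n - 1, by omega⟩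
  rw [eps_sum, eps_sum, Finset.sum_range_succ', if_neg h, add_zero]
  refine Finset.sum_congr rfl fun i hi => ?_
  have := Finset.mem_range.1 hi
  rw [hxy (i + 1) (by omega) (by omega), hxy (i + 2) (by omega) (by omega)]

theorem Dg_top (n : ℕ) (hn : 1 ≤ n) (x y : Equiv.Perm ℕ) (a : ℕ → ℤ) (d : ℤ)
    (hxy : ∀ i, 1 ≤ i → i + 1 ≤ n →
      (x⁻¹ (i + 1) : ℤ) - (x⁻¹ i : ℤ) = (y⁻¹ (i + 1) : ℤ) - (y⁻¹ i : ℤ))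
    (h : (x⁻¹ (n + 1) : ℤ) - (x⁻¹ n : ℤ) = d) :
    Dg (Finset.Icc 1 n) x a = Dg (Finset.Icc 1 (n - 1)) y a + d * a n := by
  obtain ⟨m, rfl⟩ : ∃ m, n = m + 1 := ⟨n - 1, by omega⟩
  unfold Dg
  rw [show m + 1 - 1 = m by omega, Finset.sum_Icc_succ_top (by omega), h, mul_comm d]
  congr 1
  refine Finset.sum_congr rfl fun i hi => ?_
  have := Finset.mem_Icc.1 hi
  rw [hxy i (by omega) (by omega)]

theorem wLong_in (b k : ℕ) (h1 : 1 ≤ k) (h2 : k ≤ b) : wLong 1 b k = 1 + b - k := by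
  show (if 1 ≤ k ∧ k ≤ b then 1 + b - k else k) = _
  rw [if_pos ⟨h1, h2⟩]

theorem wLong_out (b k : ℕ) (h : b < k) : wLong 1 b k = k := by
  show (if 1 ≤ k ∧ k ≤ b then 1 + b - k else k) = _
  rw [if_neg (by omega)]

theorem wLong_inv (b : ℕ) : (wLong 1 b)⁻¹ = wLong 1 b := rfl

theorem asm {e e' : ℕ} {D D' t : ℤ} (he : e = e') (hD : D = D' + t) :
    (-1 : RatFunc ℚ) ^ e * q ^ (-D) = (-1 : RatFunc ℚ) ^ e' * q ^ (-D') * q ^ (-t) := by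
  have hq : q ≠ 0 := RatFunc.X_ne_zero
  rw [he, hD, mul_assoc, ← zpow_add₀ hq, neg_add]

theorem residue_recursion_decreasing (n : ℕ) (hn : 3 ≤ n) (a : ℕ → ℤ)
    (hdec : ∀ i, 1 ≤ i → i + 1 ≤ n → a (i + 1) < a i) (hpos : 0 < a n)
    (w : Equiv.Perm ℕ) (hw : w ∈ Wdec 1 (n - 1)) :
    ((-1 : RatFunc ℚ) ^ eps (n + 1) w * q ^ (-Dg (Finset.Icc 1 n) w a) =
        (-1 : RatFunc ℚ) ^ (eps n w + 1) * q ^ (-Dg (Finset.Icc 1 (n - 1)) w a) * q ^ (-(a n))) ∧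
      ((-1 : RatFunc ℚ) ^ eps (n + 1) (w * wLong 1 (n + 1)) *
          q ^ (-Dg (Finset.Icc 1 n) (w * wLong 1 (n + 1)) a) =
        (-1 : RatFunc ℚ) ^ eps n (w * wLong 1 n) *
          q ^ (-Dg (Finset.Icc 1 (n - 1)) (w * wLong 1 n) a) * q ^ (a n)) ∧
      ((-1 : RatFunc ℚ) ^ eps (n + 1) (w * wLong 1 n) *
          q ^ (-Dg (Finset.Icc 1 n) (w * wLong 1 n) a) =
        (-1 : RatFunc ℚ) ^ (eps n (w * wLong 1 n) + 1) *
          q ^ (-Dg (Finset.Icc 1 (n - 1)) (w * wLong 1 n) a) * q ^ (-((n : ℤ) * a n))) ∧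
      ((-1 : RatFunc ℚ) ^ eps (n + 1) (w * wLong 1 n * wLong 1 (n + 1)) *
          q ^ (-Dg (Finset.Icc 1 n) (w * wLong 1 n * wLong 1 (n + 1)) a) =
        (-1 : RatFunc ℚ) ^ eps n w *
          q ^ (-Dg (Finset.Icc 1 (n - 1)) w a) * q ^ ((n : ℤ) * a n)) := by
  have hS : ∀ k ∉ Finset.Icc 1 (n - 1), w k = k := hw.1
  clear hw hdec hpos
  have hwn : w n = n := hS n (by simp; omega)
  have hwn1 : w (n + 1) = n + 1 := hS _ (by simp)
  have hin : w⁻¹ n = n := by rw [Equiv.Perm.inv_eq_iff_eq, hwn]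
  have hin1 : w⁻¹ (n + 1) = n + 1 := by rw [Equiv.Perm.inv_eq_iff_eq, hwn1]
  have hr : ∀ k, 1 ≤ k → k ≤ n → 1 ≤ w k ∧ w k ≤ n := by
    intro k h1 h2
    by_contra hc
    have := w.injective (hS (w k) (by simp; omega))
    omega
  have hri : ∀ k, 1 ≤ k → k ≤ n → 1 ≤ w⁻¹ k ∧ w⁻¹ k ≤ n := by
    intro k h1 h2
    by_contra hc
    have := hS (w⁻¹ k) (by simp only [Finset.mem_Icc]; omega)
    rw [show w (w⁻¹ k) = k from w.apply_symm_apply k] at this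
    omega
  refine ⟨?_, ?_, ?_, ?_⟩
  · apply asm (eps_top n (by omega) w (by omega))
    rw [Dg_top n (by omega) w w a 1 (fun _ _ _ => rfl) (by rw [hin, hin1]; push_cast; ring)]
    ring
  · have := asm (eps_shift n (by omega) (w * wLong 1 (n + 1)) (w * wLong 1 n) ?_ ?_)
      (Dg_top n (by omega) (w * wLong 1 (n + 1)) (w * wLong 1 n) a (-1) ?_ ?_)
    · rw [this]; congr 2; ring
    · simp only [Equiv.Perm.mul_apply]
      rw [wLong_in _ _ (by omega) (by omega), wLong_in _ _ (by omega) (by omega),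
        show 1 + (n + 1) - 1 = n + 1 by omega, show 1 + (n + 1) - 2 = n by omega]
      omega
    · intro i h1 h2
      simp only [Equiv.Perm.mul_apply]
      rw [wLong_in _ _ (by omega) (by omega), wLong_in _ _ (by omega) (by omega)]
      congr 1; omega
    · intro i h1 h2
      have A := hri i (by omega) (by omega)
      have B := hri (i + 1) (by omega) (by omega)
      simp only [mul_inv_rev, wLong_inv, Equiv.Perm.mul_apply]
      rw [wLong_in (n + 1) _ (by omega) (by omega), wLong_in (n + 1) _ (by omega) (by omega),
        wLong_in n _ (by omega) (by omega), wLong_in n _ (by omega) (by omega)]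
      omega
    · simp only [mul_inv_rev, wLong_inv, Equiv.Perm.mul_apply]
      rw [hin, hin1, wLong_in (n + 1) _ (by omega) (by omega),
        wLong_in (n + 1) _ (by omega) (by omega)]
      omega
  · refine asm (eps_top n (by omega) _ ?_) (Dg_top n (by omega) _ _ a n (fun _ _ _ => rfl) ?_)
    · simp only [Equiv.Perm.mul_apply]
      have := hr 1 (by omega) (by omega)
      rw [wLong_in n n (by omega) (by omega), wLong_out n (n + 1) (by omega),
        show 1 + n - n = 1 by omega]
      omega
    · simp only [mul_inv_rev, wLong_inv, Equiv.Perm.mul_apply]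
      rw [hin, hin1, wLong_in n n (by omega) (by omega), wLong_out n (n + 1) (by omega)]
      omega
  · have := asm (eps_shift n (by omega) (w * wLong 1 n * wLong 1 (n + 1)) w ?_ ?_)
      (Dg_top n (by omega) (w * wLong 1 n * wLong 1 (n + 1)) w a (-n) ?_ ?_)
    · rw [this]; congr 2; ring
    · simp only [Equiv.Perm.mul_apply]
      have := hr 1 (by omega) (by omega)
      rw [wLong_in (n + 1) 1 (by omega) (by omega), wLong_in (n + 1) 2 (by omega) (by omega),
        show 1 + (n + 1) - 1 = n + 1 by omega, show 1 + (n + 1) - 2 = n by omega,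
        wLong_in n n (by omega) (by omega), wLong_out n (n + 1) (by omega),
        show 1 + n - n = 1 by omega]
      omega
    · intro i h1 h2
      simp only [Equiv.Perm.mul_apply]
      rw [wLong_in (n + 1) _ (by omega) (by omega), wLong_in n _ (by omega) (by omega)]
      congr 1; omega
    · intro i h1 h2
      have A := hri i (by omega) (by omega)
      have B := hri (i + 1) (by omega) (by omega)
      simp only [mul_inv_rev, wLong_inv, Equiv.Perm.mul_apply]
      rw [wLong_in n _ (by omega) (by omega), wLong_in n _ (by omega) (by omega),
        wLong_in (n + 1) _ (by omega) (by omega), wLong_in (n + 1) _ (by omega) (by omega)]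
      omega
    · simp only [mul_inv_rev, wLong_inv, Equiv.Perm.mul_apply]
      rw [hin, hin1, wLong_in n n (by omega) (by omega), wLong_out n (n + 1) (by omega),
        wLong_in (n + 1) _ (by omega) (by omega), wLong_in (n + 1) _ (by omega) (by omega)]
      omega
end

section
/- Let n ≥ 3, let 0 < a_1 < a_2 < ⋯ < a_n be integers, and set λ := Σ_{i=1}^{n} a_i α_i and λ′ := Σ_{i=2}^{n} a_i α_i. Then for every permutation w of {1,…,n+1} that fixes 1 and 2 and belongs to W^{inc}({3,…,n+1}), the following four identities hold in ℚ(q): (1) (−1)^{ε(w)} q^{−D(w,λ)} = (−1)^{ε̃(w)+1} q^{−D(w,λ′)} · q^{−a_1}; (2) (−1)^{ε(w∘u)} q^{−D(w∘u,λ)} = (−1)^{ε̃(w∘v)} q^{−D(w∘v,λ′)} · q^{a_1}; (3) (−1)^{ε(w∘v)} q^{−D(w∘v,λ)} = (−1)^{ε̃(w∘v)+1} q^{−D(w∘v,λ′)} · q^{−n·a_1}; (4) (−1)^{ε(w∘v∘u)} q^{−D(w∘v∘u,λ)} = (−1)^{ε̃(w)} q^{−D(w,λ′)} · q^{n·a_1}.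 -/
/-- `ε̃(x) = #{i ∈ {2,…,n} : x(i) < x(i+1)}`. -/
def epsT (n : ℕ) (x : Equiv.Perm ℕ) : ℕ :=
  ((Finset.Icc 2 n).filter fun i => x i < x (i + 1)).card

theorem hlp_icc (n : ℕ) (hn : 3 ≤ n) : Finset.Icc 1 n = insert 1 (Finset.Icc 2 n) := by
  ext i; simp only [Finset.mem_Icc, Finset.mem_insert]; omega

theorem hlp_eps (n : ℕ) (hn : 3 ≤ n) (x : Equiv.Perm ℕ) (h : x 1 < x 2) :
    eps (n + 1) x = epsT n x + 1 := by
  unfold eps epsT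
  rw [Nat.add_sub_cancel, hlp_icc n hn, Finset.filter_insert, if_pos h,
    Finset.card_insert_of_notMem (by simp)]

theorem hlp_D (n : ℕ) (hn : 3 ≤ n) (x : Equiv.Perm ℕ) (c : ℕ → ℤ) :
    Dg (Finset.Icc 1 n) x c =
      c 1 * ((x⁻¹ 2 : ℕ) - (x⁻¹ 1 : ℕ) : ℤ) + Dg (Finset.Icc 2 n) x c := by
  unfold Dg
  rw [hlp_icc n hn, Finset.sum_insert (by simp)]

theorem hlp_eps_shift (n : ℕ) (hn : 3 ≤ n) (x y : Equiv.Perm ℕ)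
    (h : ∀ i, 1 ≤ i → i ≤ n → x i = y (i + 1)) (hl : x (n + 1) < x n) :
    eps (n + 1) x = epsT n y := by
  unfold eps epsT
  rw [Nat.add_sub_cancel]
  apply Finset.card_bij (fun i _ => i + 1)
  · intro i hi
    simp only [Finset.mem_filter, Finset.mem_Icc] at hi ⊢
    obtain ⟨⟨h1, h2⟩, h3⟩ := hi
    have hne : i ≠ n := by rintro rfl; omega
    rw [← h i h1 h2, ← h (i + 1) (by omega) (by omega)]
    exact ⟨by omega, h3⟩
  · intro i _ j _ hij
    exact Nat.succ.inj hij
  · intro j hj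
    simp only [Finset.mem_filter, Finset.mem_Icc] at hj
    obtain ⟨⟨h1, h2⟩, h3⟩ := hj
    obtain ⟨i, rfl⟩ : ∃ i, j = i + 1 := ⟨j - 1, by omega⟩
    refine ⟨i, ?_, rfl⟩
    simp only [Finset.mem_filter, Finset.mem_Icc]
    rw [h i (by omega) (by omega), h (i + 1) (by omega) (by omega)]
    exact ⟨by omega, h3⟩

theorem hlp_D_shift (n : ℕ) (x y : Equiv.Perm ℕ) (c : ℕ → ℤ)
    (h : ∀ j, 2 ≤ j → j ≤ n + 1 → x⁻¹ j + 1 = y⁻¹ j) :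
    Dg (Finset.Icc 2 n) x c = Dg (Finset.Icc 2 n) y c := by
  unfold Dg
  apply Finset.sum_congr rfl
  intro i hi
  rw [Finset.mem_Icc] at hi
  rw [← h i (by omega) (by omega), ← h (i + 1) (by omega) (by omega)]
  push_cast; ring

theorem hlp_wL (a b k : ℕ) : wLong a b k = if a ≤ k ∧ k ≤ b then a + b - k else k := rfl

theorem hlp_wLi (a b : ℕ) : (wLong a b)⁻¹ = wLong a b := by
  rw [inv_eq_iff_mul_eq_one]
  ext k
  simp only [Equiv.Perm.mul_apply, hlp_wL, Equiv.Perm.one_apply]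
  split_ifs <;> omega

theorem hlp_q : q ≠ 0 := RatFunc.X_ne_zero

theorem residue_recursion_increasing (n : ℕ) (hn : 3 ≤ n) (a : ℕ → ℤ)
    (hpos : 0 < a 1)
    (hinc : ∀ i, 1 ≤ i → i + 1 ≤ n → a i < a (i + 1))
    (w : Equiv.Perm ℕ) (hw : w ∈ Winc 3 (n + 1)) :
    ((-1 : RatFunc ℚ) ^ eps (n + 1) w * q ^ (-Dg (Finset.Icc 1 n) w a) =
        (-1 : RatFunc ℚ) ^ (epsT n w + 1) * q ^ (-Dg (Finset.Icc 2 n) w a) * q ^ (-(a 1))) ∧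
      ((-1 : RatFunc ℚ) ^ eps (n + 1) (w * wLong 1 (n + 1)) *
          q ^ (-Dg (Finset.Icc 1 n) (w * wLong 1 (n + 1)) a) =
        (-1 : RatFunc ℚ) ^ epsT n (w * wLong 2 (n + 1)) *
          q ^ (-Dg (Finset.Icc 2 n) (w * wLong 2 (n + 1)) a) * q ^ (a 1)) ∧
      ((-1 : RatFunc ℚ) ^ eps (n + 1) (w * wLong 2 (n + 1)) *
          q ^ (-Dg (Finset.Icc 1 n) (w * wLong 2 (n + 1)) a) =
        (-1 : RatFunc ℚ) ^ (epsT n (w * wLong 2 (n + 1)) + 1) *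
          q ^ (-Dg (Finset.Icc 2 n) (w * wLong 2 (n + 1)) a) * q ^ (-((n : ℤ) * a 1))) ∧
      ((-1 : RatFunc ℚ) ^ eps (n + 1) (w * wLong 2 (n + 1) * wLong 1 (n + 1)) *
          q ^ (-Dg (Finset.Icc 1 n) (w * wLong 2 (n + 1) * wLong 1 (n + 1)) a) =
        (-1 : RatFunc ℚ) ^ epsT n w *
          q ^ (-Dg (Finset.Icc 2 n) w a) * q ^ ((n : ℤ) * a 1)) := by
  have hf := hw.1
  have h1 : w 1 = 1 := hf 1 (by simp)
  have h2 : w 2 = 2 := hf 2 (by simp)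
  have hi1 : w⁻¹ 1 = 1 := by rw [Equiv.Perm.inv_eq_iff_eq, h1]
  have hi2 : w⁻¹ 2 = 2 := by rw [Equiv.Perm.inv_eq_iff_eq, h2]
  have hr : ∀ j, 2 ≤ j → j ≤ n + 1 → 2 ≤ w j := by
    intro j a1 a2
    by_contra hc
    have h0 : w 0 = 0 := hf 0 (by simp)
    have : w j = 0 ∨ w j = 1 := by omega
    rcases this with h | h
    · have := w.injective (h.trans h0.symm); omega
    · have := w.injective (h.trans h1.symm); omega
  have hri : ∀ j, 2 ≤ j → j ≤ n + 1 → 2 ≤ w⁻¹ j ∧ w⁻¹ j ≤ n + 1 := by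
    intro j a1 a2
    have e : w (w⁻¹ j) = j := by simp
    by_contra hc
    have h3 : w⁻¹ j ∉ Finset.Icc 3 (n + 1) := by
      rw [Finset.mem_Icc]; omega
    have := hf _ h3
    omega
  have key : ∀ (e : ℕ) (s t d : ℤ), s = t + d →
      (-1 : RatFunc ℚ) ^ e * q ^ s = (-1 : RatFunc ℚ) ^ e * q ^ t * q ^ d := by
    intro e s t d h
    rw [h, zpow_add₀ hlp_q, mul_assoc]
  refine ⟨?_, ?_, ?_, ?_⟩
  · rw [hlp_eps n hn w (by omega)]
    apply key
    rw [hlp_D n hn, hi1, hi2]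
    push_cast; ring
  · rw [hlp_eps_shift n hn (w * wLong 1 (n + 1)) (w * wLong 2 (n + 1))]
    · apply key
      rw [hlp_D n hn, hlp_D_shift n (w * wLong 1 (n + 1)) (w * wLong 2 (n + 1))]
      · have e1 : (w * wLong 1 (n + 1))⁻¹ 1 = n + 1 := by
          rw [mul_inv_rev, hlp_wLi, Equiv.Perm.mul_apply, hi1, hlp_wL, if_pos (by omega)]; omega
        have e2 : (w * wLong 1 (n + 1))⁻¹ 2 = n := by
          rw [mul_inv_rev, hlp_wLi, Equiv.Perm.mul_apply, hi2, hlp_wL, if_pos (by omega)]; omega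
        rw [e1, e2]
        push_cast; ring
      · intro j a1 a2
        have := hri j a1 a2
        simp only [mul_inv_rev, hlp_wLi, Equiv.Perm.mul_apply, hlp_wL]
        rw [if_pos (by omega), if_pos (by omega)]; omega
    · intro i a1 a2
      simp only [Equiv.Perm.mul_apply, hlp_wL]
      rw [if_pos (by omega), if_pos (by omega)]; congr 1; omega
    · simp only [Equiv.Perm.mul_apply, hlp_wL]
      rw [if_pos (by omega), if_pos (by omega), show 1 + (n + 1) - (n + 1) = 1 by omega,
        show 1 + (n + 1) - n = 2 by omega]; omega
  · rw [hlp_eps n hn (w * wLong 2 (n + 1))]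
    · apply key
      have e1 : (w * wLong 2 (n + 1))⁻¹ 1 = 1 := by
        rw [mul_inv_rev, hlp_wLi, Equiv.Perm.mul_apply, hi1, hlp_wL, if_neg (by omega)]
      have e2 : (w * wLong 2 (n + 1))⁻¹ 2 = n + 1 := by
        rw [mul_inv_rev, hlp_wLi, Equiv.Perm.mul_apply, hi2, hlp_wL, if_pos (by omega)]; omega
      rw [hlp_D n hn, e1, e2]
      push_cast; ring
    · simp only [Equiv.Perm.mul_apply, hlp_wL]
      rw [if_neg (by omega), if_pos (by omega), h1]
      have := hr (2 + (n + 1) - 2) (by omega) (by omega)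
      omega
  · rw [hlp_eps_shift n hn (w * wLong 2 (n + 1) * wLong 1 (n + 1)) w]
    · apply key
      rw [hlp_D n hn, hlp_D_shift n (w * wLong 2 (n + 1) * wLong 1 (n + 1)) w]
      · have e1 : (w * wLong 2 (n + 1) * wLong 1 (n + 1))⁻¹ 1 = n + 1 := by
          simp only [mul_inv_rev, hlp_wLi, Equiv.Perm.mul_apply, hi1, hlp_wL]
          split_ifs <;> omega
        have e2 : (w * wLong 2 (n + 1) * wLong 1 (n + 1))⁻¹ 2 = 1 := by
          simp only [mul_inv_rev, hlp_wLi, Equiv.Perm.mul_apply, hi2, hlp_wL]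
          split_ifs <;> omega
        rw [e1, e2]
        push_cast; ring
      · intro j a1 a2
        have := hri j a1 a2
        simp only [mul_inv_rev, hlp_wLi, Equiv.Perm.mul_apply, hlp_wL]
        split_ifs <;> omega
    · intro i a1 a2
      simp only [Equiv.Perm.mul_apply, hlp_wL]
      congr 1
      split_ifs <;> omega
    · have e1 : (w * wLong 2 (n + 1) * wLong 1 (n + 1)) (n + 1) = w 1 := by
        simp only [Equiv.Perm.mul_apply, hlp_wL]
        congr 1
        split_ifs <;> omega
      have e2 : (w * wLong 2 (n + 1) * wLong 1 (n + 1)) n = w (n + 1) := by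
        simp only [Equiv.Perm.mul_apply, hlp_wL]
        congr 1
        split_ifs <;> omega
      have := hr (n + 1) (by omega) (by omega)
      omega
end
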